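/- An optic p : S ⇸ A is lawful if and only if the corresponding Tambara module morphism Φ_M E_S → Φ_M E_A is a comonoid homomorphism with respect to the comonoid structures on Φ_M E_S and Φ_M E_A in the monoidal category (Tamb_M, ⊙, identity profunctor) induced (via the oplax monoidal structure on Φ_M) by the comonoid structure on the exchange profunctors, namely comultiplication Δ(⟨l|r⟩) = ⟨l | id_{M·A} | r⟩ and counit ε(⟨l|r⟩) = r∘l. -/

import Mathlib

/-!
STATEMENT 19: An optic `p : S ⇸ A` is lawful if and only if the corresponding Tambara
module morphism `Φ_M E_S → Φ_M E_A` is a comonoid homomorphism with respect to the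
comonoid structures on `Φ_M E_S` and `Φ_M E_A` in `(Tamb_M, ⊙, I)` induced by the
comonoid structure of the exchange profunctors: comultiplication
`Δ(⟨l|r⟩) = ⟨l | id_{M·A} | r⟩` and counit `ε(⟨l|r⟩) = r∘l`.

Here we use the identifications granted by the context:
`Φ_M E_{A,A'}(X,Y) ≅ Optic_M((X,Y),(A,A'))`, under which the Tambara morphism
corresponding to an optic `⟨l|r⟩` is `⟨f|g⟩ ↦ ⟨(N·l)∘f | g∘(N·r)⟩` (i.e. composition of
optics), and `(Φ_M E_S ⊙ Φ_M E_S)(X,Y) ≅ ∫^{m₁,m₂} C(X,m₁·S) × C(m₁·S,m₂·S) × C(m₂·S,Y)`.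
-/

open CategoryTheory MonoidalCategory Functor.LaxMonoidal Functor.OplaxMonoidal

universe u

attribute [local instance] CategoryTheory.endofunctorMonoidalCategory

variable {M : Type u} [Category.{u} M] [MonoidalCategory M]
variable {C : Type u} [Category.{u} C]

/-- A representative of an optic `(X,Y) ⇸ (A,A')` for the action of `M` on `C`
(writing `m·A` for `(a.obj m).obj A`). -/
structure ActOpticRep (a : M ⥤ C ⥤ C) (X Y A A' : C) : Type u where
  m : M
  l : X ⟶ (a.obj m).obj A
  r : (a.obj m).obj A' ⟶ Y

variable (a : M ⥤ C ⥤ C)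

/-- The coend relation `⟨(f·A)∘l | r⟩ ∼ ⟨l | r∘(f·A')⟩` for `f : m ⟶ n` in `M`. -/
inductive ActOpticRel {X Y A A' : C} :
    ActOpticRep a X Y A A' → ActOpticRep a X Y A A' → Prop
  | slide {m n : M} (f : m ⟶ n) (l : X ⟶ (a.obj m).obj A) (r : (a.obj n).obj A' ⟶ Y) :
      ActOpticRel ⟨n, l ≫ (a.map f).app A, r⟩ ⟨m, l, (a.map f).app A' ≫ r⟩

/-- The set of optics `(X,Y) ⇸ (A,A')`. -/
def ActOptic (X Y A A' : C) : Type u :=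
  Quot (ActOpticRel a (X := X) (Y := Y) (A := A) (A' := A'))

/-- A representative of an element of
`(Φ_M E_A ⊙ Φ_M E_A)(X,Y) ≅ ∫^{m₁,m₂} C(X, m₁·A) × C(m₁·A, m₂·A) × C(m₂·A, Y)`. -/
structure Opt2Rep (X Y A : C) : Type u where
  m₁ : M
  m₂ : M
  l : X ⟶ (a.obj m₁).obj A
  c : (a.obj m₁).obj A ⟶ (a.obj m₂).obj A
  r : (a.obj m₂).obj A ⟶ Y

/-- The coend relations for `(Φ_M E_A ⊙ Φ_M E_A)(X,Y)`. -/
inductive Opt2Rel {X Y A : C} : Opt2Rep a X Y A → Opt2Rep a X Y A → Prop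
  | slideL {m₁ n₁ m₂ : M} (f : m₁ ⟶ n₁) (l : X ⟶ (a.obj m₁).obj A)
      (c : (a.obj n₁).obj A ⟶ (a.obj m₂).obj A) (r : (a.obj m₂).obj A ⟶ Y) :
      Opt2Rel ⟨n₁, m₂, l ≫ (a.map f).app A, c, r⟩ ⟨m₁, m₂, l, (a.map f).app A ≫ c, r⟩
  | slideR {m₁ m₂ n₂ : M} (g : m₂ ⟶ n₂) (l : X ⟶ (a.obj m₁).obj A)
      (c : (a.obj m₁).obj A ⟶ (a.obj m₂).obj A) (r : (a.obj n₂).obj A ⟶ Y) :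
      Opt2Rel ⟨m₁, n₂, l, c ≫ (a.map g).app A, r⟩ ⟨m₁, m₂, l, c, (a.map g).app A ≫ r⟩

def Opt2 (X Y A : C) : Type u :=
  Quot (Opt2Rel a (X := X) (Y := Y) (A := A))

/-- `once(⟨l|r⟩) = ⟨l | id | r⟩` (at general endpoints, this is the comultiplication
`Δ : Φ_M E_A(X,Y) → (Φ_M E_A ⊙ Φ_M E_A)(X,Y)` of the exchange-comonoid). -/
def deltaRep {X Y A : C} (w : ActOpticRep a X Y A A) : Opt2 a X Y A :=
  Quot.mk _ ⟨w.m, w.m, w.l, 𝟙 ((a.obj w.m).obj A), w.r⟩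

/-- `twice(⟨l|r⟩) = ⟨l | l∘r | r⟩`. -/
def twiceRep {S A : C} (w : ActOpticRep a S S A A) : Opt2 a S S A :=
  Quot.mk _ ⟨w.m, w.m, w.l, w.r ≫ w.l, w.r⟩

/-- An optic `p : S ⇸ A` is lawful if `outside(p) = id_S` and `once(p) = twice(p)`. -/
def ActOptic.Lawful {S A : C} (p : ActOptic a S S A A) : Prop :=
  ∀ rep : ActOpticRep a S S A A, Quot.mk _ rep = p →
    rep.l ≫ rep.r = 𝟙 S ∧ deltaRep a rep = twiceRep a rep

variable [a.Monoidal]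

/-- The value on `⟨f|g⟩ : Φ_M E_{S,S}(X,Y)` of the Tambara module morphism
`Φ_M E_S → Φ_M E_A` corresponding to an optic with representative `q = ⟨l|r⟩`:
`⟨f|g⟩ ↦ ⟨(N·l)∘f | g∘(N·r)⟩`, i.e. composition of optics. -/
def tRep {X Y S A : C} (q : ActOpticRep a S S A A) (w : ActOpticRep a X Y S S) :
    ActOpticRep a X Y A A where
  m := q.m ⊗ w.m
  l := w.l ≫ (a.obj w.m).map q.l ≫ (μ a q.m w.m).app A
  r := (δ a q.m w.m).app A ≫ (a.obj w.m).map q.r ≫ w.r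

/-- The value of `t ⊙ t : Φ_M E_S ⊙ Φ_M E_S → Φ_M E_A ⊙ Φ_M E_A` on a representative
`⟨f | c | g⟩`, where the two factors of `t` are computed with (possibly different)
representatives `q₁`, `q₂` of the same optic. -/
def ttRep {X Y S A : C} (q₁ q₂ : ActOpticRep a S S A A) (w : Opt2Rep a X Y S) :
    Opt2Rep a X Y A where
  m₁ := q₁.m ⊗ w.m₁
  m₂ := q₂.m ⊗ w.m₂
  l := w.l ≫ (a.obj w.m₁).map q₁.l ≫ (μ a q₁.m w.m₁).app A
  c := (δ a q₁.m w.m₁).app A ≫ (a.obj w.m₁).map q₁.r ≫ w.c ≫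
        (a.obj w.m₂).map q₂.l ≫ (μ a q₂.m w.m₂).app A
  r := (δ a q₂.m w.m₂).app A ≫ (a.obj w.m₂).map q₂.r ≫ w.r

/-- The right unit law, on the `l` side. -/
theorem unit_l_aux {S B : C} (m : M) (l : S ⟶ (a.obj m).obj B) :
    (show S ⟶ (a.obj (m ⊗ 𝟙_ M)).obj B from
      (ε a).app S ≫ (a.obj (𝟙_ M)).map l ≫ (μ a m (𝟙_ M)).app B) =
      l ≫ (a.map (ρ_ m).inv).app B := by
  have h := CategoryTheory.obj_zero_map_μ_app a l
  have h2 := CategoryTheory.ε_η_app a S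
  change (ε a).app S ≫ (a.obj (𝟙_ M)).map l ≫ (μ a m (𝟙_ M)).app B = _
  erw [h, ← Category.assoc, h2, Category.id_comp]

/-- The right unit law, on the `r` side. -/
theorem unit_r_aux {S B : C} (m : M) (r : (a.obj m).obj B ⟶ S) :
    (show (a.obj (m ⊗ 𝟙_ M)).obj B ⟶ S from
      (δ a m (𝟙_ M)).app B ≫ (a.obj (𝟙_ M)).map r ≫ (η a).app S) =
      (a.map (ρ_ m).hom).app B ≫ r := by
  have h : (a.obj (𝟙_ M)).map r ≫ (η a).app S = (η a).app ((a.obj m).obj B) ≫ r :=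
    (η a).naturality r
  have h2 := CategoryTheory.η_app_obj a m B
  have h3 := CategoryTheory.δ_μ_app a m (𝟙_ M) B
  change (δ a m (𝟙_ M)).app B ≫ (a.obj (𝟙_ M)).map r ≫ (η a).app S = _
  rw [h, h2]
  erw [Category.assoc, reassoc_of% h3]

/-- The action of a representative `w` on `Opt2`, at the level of representatives. -/
def actRep {X Y S A : C} (w : ActOpticRep a X Y S S) (x : Opt2Rep a S S A) :
    Opt2Rep a X Y A where
  m₁ := x.m₁ ⊗ w.m
  m₂ := x.m₂ ⊗ w.m
  l := w.l ≫ (a.obj w.m).map x.l ≫ (μ a x.m₁ w.m).app A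
  c := (δ a x.m₁ w.m).app A ≫ (a.obj w.m).map x.c ≫ (μ a x.m₂ w.m).app A
  r := (δ a x.m₂ w.m).app A ≫ (a.obj w.m).map x.r ≫ w.r

theorem mk2_congr {X Y A : C} {m₁ m₂ : M} {l lb : X ⟶ (a.obj m₁).obj A}
    {c cb : (a.obj m₁).obj A ⟶ (a.obj m₂).obj A} {r rb : (a.obj m₂).obj A ⟶ Y}
    (hl : l = lb) (hc : c = cb) (hr : r = rb) :
    (Quot.mk _ ⟨m₁, m₂, l, c, r⟩ : Opt2 a X Y A) = Quot.mk _ ⟨m₁, m₂, lb, cb, rb⟩ := by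
  subst hl hc hr; rfl

theorem slide_l_aux {X S A : C} {m n k : M} (f : m ⟶ n) (u : X ⟶ (a.obj k).obj S)
    (l : S ⟶ (a.obj m).obj A) :
    (show X ⟶ (a.obj (n ⊗ k)).obj A from
      u ≫ (a.obj k).map (l ≫ (a.map f).app A) ≫ (μ a n k).app A) =
    (show X ⟶ (a.obj (m ⊗ k)).obj A from
      u ≫ (a.obj k).map l ≫ (μ a m k).app A) ≫ (a.map (f ▷ k)).app A := by
  have h1 := CategoryTheory.μ_naturalityₗ a (n := k) f A
  change u ≫ (a.obj k).map (l ≫ (a.map f).app A) ≫ (μ a n k).app A =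
    (u ≫ (a.obj k).map l ≫ (μ a m k).app A) ≫ (a.map (f ▷ k)).app A
  rw [Functor.map_comp, Category.assoc]
  erw [h1, Category.assoc, Category.assoc]

theorem slide_r_aux {Y S A : C} {m n k : M} (f : m ⟶ n) (u : (a.obj k).obj S ⟶ Y)
    (r : (a.obj n).obj A ⟶ S) :
    (show (a.obj (m ⊗ k)).obj A ⟶ Y from
      (δ a m k).app A ≫ (a.obj k).map ((a.map f).app A ≫ r) ≫ u) =
    (a.map (f ▷ k)).app A ≫ (show (a.obj (n ⊗ k)).obj A ⟶ Y from
      (δ a n k).app A ≫ (a.obj k).map r ≫ u) := by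
  have h2 := CategoryTheory.δ_naturalityₗ a (n := k) f A
  change (δ a m k).app A ≫ (a.obj k).map ((a.map f).app A ≫ r) ≫ u =
    (a.map (f ▷ k)).app A ≫ (δ a n k).app A ≫ (a.obj k).map r ≫ u
  rw [Functor.map_comp, Category.assoc]
  erw [reassoc_of% h2]

/-- The action of a representative `w` on `Opt2`. -/
def act2 {X Y S A : C} (w : ActOpticRep a X Y S S) : Opt2 a S S A → Opt2 a X Y A :=
  Quot.lift (fun x => Quot.mk _ (actRep a w x)) (by
    rintro _ _ (⟨f, l, c, r⟩ | ⟨g, l, c, r⟩)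
    · rename_i m₁ n₁ m₂
      have key := Opt2Rel.slideL (a := a) (f ▷ w.m)
        (w.l ≫ (a.obj w.m).map l ≫ (μ a m₁ w.m).app A)
        ((δ a n₁ w.m).app A ≫ (a.obj w.m).map c ≫ (μ a m₂ w.m).app A)
        ((δ a m₂ w.m).app A ≫ (a.obj w.m).map r ≫ w.r)
      exact (mk2_congr a (slide_l_aux a f w.l l) rfl rfl).trans
        ((Quot.sound key).trans
          (mk2_congr a rfl (slide_r_aux a f ((μ a m₂ w.m).app A) c).symm rfl))
    · rename_i m₁ m₂ n₂
      have key := Opt2Rel.slideR (a := a) (g ▷ w.m)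
        (w.l ≫ (a.obj w.m).map l ≫ (μ a m₁ w.m).app A)
        ((δ a m₁ w.m).app A ≫ (a.obj w.m).map c ≫ (μ a m₂ w.m).app A)
        ((δ a n₂ w.m).app A ≫ (a.obj w.m).map r ≫ w.r)
      exact (mk2_congr a rfl
          ((slide_l_aux a g ((δ a m₁ w.m).app A) c).trans rfl) rfl).trans
        ((Quot.sound key).trans (mk2_congr a rfl rfl (slide_r_aux a g w.r r).symm)))

theorem act2_delta {X Y S A : C} (w : ActOpticRep a X Y S S) (q : ActOpticRep a S S A A) :
    act2 a w (deltaRep a q) = deltaRep a (tRep a q w) := by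
  refine mk2_congr a rfl ?_ rfl
  have h := CategoryTheory.δ_μ_app a q.m w.m A
  change (δ a q.m w.m).app A ≫ (a.obj w.m).map (𝟙 ((a.obj q.m).obj A)) ≫
    (μ a q.m w.m).app A = 𝟙 ((a.obj (q.m ⊗ w.m)).obj A)
  rw [CategoryTheory.Functor.map_id]
  refine Eq.trans ?_ h
  congr 1
  exact Category.id_comp _

/-- `⟨l₁ | l₂∘r₁ | r₂⟩`, at the level of representatives. -/
def mixRep {S A : C} (q₁ q₂ : ActOpticRep a S S A A) : Opt2 a S S A :=
  Quot.mk _ ⟨q₁.m, q₂.m, q₁.l, q₁.r ≫ q₂.l, q₂.r⟩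

theorem mixRep_congr {S A : C} (q₁ q₂ q₃ : ActOpticRep a S S A A)
    (h : (Quot.mk _ q₂ : ActOptic a S S A A) = Quot.mk _ q₃) :
    mixRep a q₁ q₂ = mixRep a q₁ q₃ := by
  have hr : ∀ x y, ActOpticRel a x y → mixRep a q₁ x = mixRep a q₁ y := by
    rintro _ _ ⟨f, l, r⟩
    exact (mk2_congr a rfl (Category.assoc _ _ _).symm rfl).trans
      (Quot.sound (Opt2Rel.slideR (a := a) f q₁.l (q₁.r ≫ l) r))
  exact congrArg (Quot.lift (mixRep a q₁) hr) h

theorem act2_mix {X Y S A : C} (w : ActOpticRep a X Y S S) (q₁ q₂ : ActOpticRep a S S A A) :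
    act2 a w (mixRep a q₁ q₂) =
      Quot.mk _ (ttRep a q₁ q₂ ⟨w.m, w.m, w.l, 𝟙 ((a.obj w.m).obj S), w.r⟩) := by
  change Quot.mk _ _ = Quot.mk _ _
  simp [actRep, ttRep]

/-- The representative of the identity optic. -/
def unitRep (S : C) : ActOpticRep a S S S S where
  m := 𝟙_ M
  l := (ε a).app S
  r := (η a).app S

theorem act2_unit {S A : C} (x : Opt2 a S S A) : act2 a (unitRep a S) x = x := by
  induction x using Quot.ind with
  | mk x =>
  obtain ⟨m₁, m₂, l, c, r⟩ := x
  have k1 := Quot.sound (Opt2Rel.slideL (a := a) (ρ_ m₁).inv l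
    ((actRep a (unitRep a S) ⟨m₁, m₂, l, c, r⟩).c)
    ((actRep a (unitRep a S) ⟨m₁, m₂, l, c, r⟩).r))
  rw [← unit_l_aux a m₁ l] at k1
  refine Eq.trans k1 ?_
  have k2 := Quot.sound (Opt2Rel.slideR (a := a) (ρ_ m₂).hom l
    ((a.map (ρ_ m₁).inv).app A ≫ (actRep a (unitRep a S) ⟨m₁, m₂, l, c, r⟩).c) r)
  rw [← unit_r_aux a m₂ r] at k2
  refine Eq.trans k2.symm ?_
  have hc : ((a.map (ρ_ m₁).inv).app A ≫ (actRep a (unitRep a S) ⟨m₁, m₂, l, c, r⟩).c) ≫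
      (a.map (ρ_ m₂).hom).app A = c := by
    have h := CategoryTheory.obj_zero_map_μ_app a c
    have h1 := CategoryTheory.ε_app_obj a m₁ A
    have h2 := CategoryTheory.ε_η_app a ((a.obj m₁).obj A)
    have h3 : (a.map (ρ_ m₂).inv).app A ≫ (a.map (ρ_ m₂).hom).app A = 𝟙 _ := by
      rw [← NatTrans.comp_app, ← a.map_comp]; simp
    dsimp only [actRep, unitRep]
    erw [h]
    simp only [Category.assoc]
    erw [← reassoc_of% h1, reassoc_of% h2, h3, Category.comp_id]
  exact mk2_congr a rfl hc rfl

theorem counit_aux {X Y S A : C} (q : ActOpticRep a S S A A) (w : ActOpticRep a X Y S S) :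
    (tRep a q w).l ≫ (tRep a q w).r = w.l ≫ (a.obj w.m).map (q.l ≫ q.r) ≫ w.r := by
  have h := CategoryTheory.μ_δ_app a q.m w.m A
  simp only [tRep, Category.assoc, Functor.map_comp]
  erw [reassoc_of% h]

/-- **Statement 19.** An optic `p : S ⇸ A` is lawful iff the corresponding Tambara
module morphism `t : Φ_M E_S → Φ_M E_A` is a comonoid homomorphism: `ε ∘ t = ε`
(preservation of the counit `ε⟨f|g⟩ = g∘f`) and `Δ ∘ t = (t ⊙ t) ∘ Δ` (preservation of
the comultiplication `Δ⟨f|g⟩ = ⟨f | id | g⟩`), componentwise at every `(X,Y)` and on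
every representative. -/
theorem lawful_iff_comonoid_homomorphism {S A : C} (p : ActOptic a S S A A) :
    ActOptic.Lawful a p ↔
      ((∀ (X Y : C) (q : ActOpticRep a S S A A) (w : ActOpticRep a X Y S S),
          Quot.mk _ q = p → (tRep a q w).l ≫ (tRep a q w).r = w.l ≫ w.r) ∧
       (∀ (X Y : C) (q₁ q₂ : ActOpticRep a S S A A) (w : ActOpticRep a X Y S S),
          Quot.mk _ q₁ = p → Quot.mk _ q₂ = p →
          deltaRep a (tRep a q₁ w) =
            (Quot.mk _ (ttRep a q₁ q₂ ⟨w.m, w.m, w.l, 𝟙 ((a.obj w.m).obj S), w.r⟩) :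
              Opt2 a X Y A))) := by
  constructor
  · intro h
    refine ⟨fun X Y q w hq => ?_, fun X Y q₁ q₂ w h₁ h₂ => ?_⟩
    · rw [counit_aux, (h q hq).1]
      simp
    · rw [← act2_delta, (h q₁ h₁).2, ← act2_mix]
      exact congrArg _ (mixRep_congr a q₁ q₁ q₂ (h₁.trans h₂.symm))
  · rintro ⟨h1, h2⟩ q hq
    constructor
    · have h := h1 S S q (unitRep a S) hq
      rw [counit_aux] at h
      have e := CategoryTheory.ε_η_app a S
      have n := CategoryTheory.ε_naturality a (q.l ≫ q.r)
      dsimp only [unitRep] at h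
      erw [reassoc_of% n, e, Category.comp_id] at h
      exact h
    · have h := h2 S S q q (unitRep a S) hq hq
      rw [← act2_delta, ← act2_mix, act2_unit, act2_unit] at h
      exact h
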